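/- Let N ≥ 1 and d ≥ 1 be integers, let 1_N ∈ ℝ^N be the all-ones vector, and let J = I_N − 1_N 1_Nᵀ/N. Suppose α, β ∈ ℝ^N and Z, W ∈ ℝ^{N×d} satisfy the centering constraints JZ = Z and JW = W, and that α 1_Nᵀ + 1_N αᵀ + Z Zᵀ = β 1_Nᵀ + 1_N βᵀ + W Wᵀ. Then α = β, Z Zᵀ = W Wᵀ, and there exists an orthogonal matrix O ∈ ℝ^{d×d} (OᵀO = I_d) such that W = Z O. In other words, under the centering constraint the parameters of the inner-product latent space model are identifiable, with the latent position matrix identifiable up to an orthogonal transformation of its rows. -/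

import Mathlib

open Matrix

/-- Two families of vectors with the same pairwise inner products in a finite-dimensional inner
product space are related by a linear isometry. -/
theorem exists_linearIsometry_apply_eq_of_inner_eq {ι E : Type*} [NormedAddCommGroup E]
    [InnerProductSpace ℝ E] [FiniteDimensional ℝ E] (v w : ι → E)
    (h : ∀ i j, inner ℝ (v i) (v j) = inner ℝ (w i) (w j)) :
    ∃ L : E →ₗᵢ[ℝ] E, ∀ i, L (v i) = w i := by
  set V := Finsupp.linearCombination ℝ v with hV
  set T := Finsupp.linearCombination ℝ w with hT
  have hnorm (c : ι →₀ ℝ) : ‖T c‖ = ‖V c‖ := by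
    rw [← sq_eq_sq₀ (norm_nonneg _) (norm_nonneg _), ← real_inner_self_eq_norm_sq,
      ← real_inner_self_eq_norm_sq, hV, hT]
    simp only [Finsupp.linearCombination_apply, Finsupp.sum, sum_inner, inner_sum,
      real_inner_smul_left, real_inner_smul_right, h]
  obtain ⟨S, hS⟩ := V.rangeRestrict.exists_rightInverse_of_surjective V.range_rangeRestrict
  have hVS (x : LinearMap.range V) : V (S x) = x :=
    congrArg Subtype.val (LinearMap.congr_fun hS x)
  let L : LinearMap.range V →ₗᵢ[ℝ] E :=
    { toLinearMap := T ∘ₗ S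
      norm_map' := fun x => by
        rw [LinearMap.comp_apply, hnorm, hVS, Submodule.coe_norm] }
  refine ⟨L.extend, fun i => ?_⟩
  have hVi : V (Finsupp.single i 1) = v i := by simp [hV]
  have hTi : T (Finsupp.single i 1) = w i := by simp [hT]
  have hmem : v i ∈ LinearMap.range V := ⟨_, hVi⟩
  rw [show L.extend (v i) = L ⟨v i, hmem⟩ from L.extend_apply ⟨v i, hmem⟩]
  change T (S ⟨v i, hmem⟩) = w i
  rw [← hTi, ← sub_eq_zero, ← map_sub, ← norm_eq_zero, hnorm, map_sub, hVS, hVi, sub_self,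
    norm_zero]

/-- Real matrices with the same Gram matrix of rows differ by an orthogonal matrix. -/
theorem Matrix.exists_orthogonal_eq_mul_of_mul_transpose_eq {m n : Type*} [Fintype n]
    [DecidableEq n] (Z W : Matrix m n ℝ) (h : Z * Zᵀ = W * Wᵀ) :
    ∃ O : Matrix n n ℝ, Oᵀ * O = 1 ∧ W = Z * O := by
  have hinner (A : Matrix m n ℝ) (i j : m) :
      inner ℝ (WithLp.toLp 2 (A i)) (WithLp.toLp 2 (A j)) = (A * Aᵀ) i j := by
    simp [PiLp.inner_apply, Matrix.mul_apply, mul_comm]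
  obtain ⟨L, hL⟩ := exists_linearIsometry_apply_eq_of_inner_eq
    (fun i => WithLp.toLp 2 (Z i)) (fun i => WithLp.toLp 2 (W i))
    (fun i j => by rw [hinner, hinner, h])
  let b := EuclideanSpace.basisFun n ℝ
  refine ⟨Matrix.of fun i j => L (b i) j, ?_, ?_⟩
  · rw [mul_eq_one_comm]
    ext i j
    have hij : inner ℝ (L (b i)) (L (b j)) = (1 : Matrix n n ℝ) i j := by
      rw [L.inner_map_map, b.inner_eq_ite, Matrix.one_apply]
    simp [← hij, PiLp.inner_apply, Matrix.mul_apply, mul_comm, -LinearIsometry.inner_map_map]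
  · ext k j
    have hk : WithLp.toLp 2 (Z k) = ∑ i, Z k i • b i := by
      simpa [b] using (b.sum_repr (WithLp.toLp 2 (Z k))).symm
    have hW : W k j = L (WithLp.toLp 2 (Z k)) j := by rw [hL]
    rw [hW, hk]
    simp [Matrix.mul_apply]

/-- The columns of a matrix fixed by the centering projection sum to zero. -/
theorem Matrix.sum_col_eq_zero_of_centering_mul_eq {N : ℕ} {n : Type*}
    (hN : 1 ≤ N) (Z : Matrix (Fin N) n ℝ)
    (hZ : (1 - Matrix.of (fun _ _ : Fin N => (1 : ℝ) / N)) * Z = Z) (j : n) :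
    ∑ i, Z i j = 0 := by
  have h := congrFun (congrFun hZ ⟨0, hN⟩) j
  have hN' : (N : ℝ) ≠ 0 := by positivity
  rw [Matrix.sub_mul, Matrix.one_mul, Matrix.sub_apply, sub_eq_self, Matrix.mul_apply] at h
  simpa [← Finset.mul_sum, hN'] using h

/-- If the columns of `Z` sum to zero, then so do the rows of `Z Zᵀ`. -/
theorem Matrix.sum_row_mul_transpose_eq_zero {m n : Type*} [Fintype m] [Fintype n]
    (Z : Matrix m n ℝ) (hZ : ∀ j, ∑ i, Z i j = 0) (i : m) :
    ∑ j, (Z * Zᵀ) i j = 0 := by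
  simp only [Matrix.mul_apply, Matrix.transpose_apply]
  rw [Finset.sum_comm]
  simp [← Finset.mul_sum, hZ]

/-- Identifiability of the inner-product latent space model under the centering constraint:
if `α 1ᵀ + 1 αᵀ + Z Zᵀ = β 1ᵀ + 1 βᵀ + W Wᵀ` with `J Z = Z` and `J W = W`, where
`J = I − 1 1ᵀ / N`, then `α = β`, `Z Zᵀ = W Wᵀ`, and `W = Z O` for some orthogonal `O`. -/
theorem latent_space_identifiability
    (N d : ℕ) (hN : 1 ≤ N) (hd : 1 ≤ d)
    (α β : Fin N → ℝ) (Z W : Matrix (Fin N) (Fin d) ℝ)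
    (J : Matrix (Fin N) (Fin N) ℝ)
    (hJ : J = 1 - Matrix.of (fun _ _ : Fin N => (1 : ℝ) / N))
    (hZ : J * Z = Z) (hW : J * W = W)
    (heq : (Matrix.of fun i j : Fin N => α i + α j) + Z * Zᵀ =
           (Matrix.of fun i j : Fin N => β i + β j) + W * Wᵀ) :
    α = β ∧ Z * Zᵀ = W * Wᵀ ∧
      ∃ O : Matrix (Fin d) (Fin d) ℝ, Oᵀ * O = 1 ∧ W = Z * O := by
  subst hJ
  have hZ0 := sum_row_mul_transpose_eq_zero Z (sum_col_eq_zero_of_centering_mul_eq hN Z hZ)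
  have hW0 := sum_row_mul_transpose_eq_zero W (sum_col_eq_zero_of_centering_mul_eq hN W hW)
  have hN' : (0 : ℝ) < N := by positivity
  have hrow (i : Fin N) : N * α i + ∑ j, α j = N * β i + ∑ j, β j := by
    have h := congrArg (fun M : Matrix (Fin N) (Fin N) ℝ => ∑ j, M i j) heq
    simpa [Matrix.add_apply, Finset.sum_add_distrib, hZ0, hW0] using h
  have hsum : ∑ j, α j = ∑ j, β j := by
    have h := Finset.sum_congr (rfl : (Finset.univ : Finset (Fin N)) = _) fun i _ => hrow i
    simp only [Finset.sum_add_distrib, ← Finset.mul_sum, Finset.sum_const, Finset.card_univ,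
      Fintype.card_fin, nsmul_eq_mul] at h
    exact mul_left_cancel₀ hN'.ne' (by linarith)
  have hαβ : α = β := by
    ext i
    exact mul_left_cancel₀ hN'.ne' (by linarith [hrow i])
  subst hαβ
  have hgram := add_left_cancel heq
  exact ⟨rfl, hgram, exists_orthogonal_eq_mul_of_mul_transpose_eq Z W hgram⟩
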